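/- For any coprime positive integers a ≠ u, with Δ := u² − a² and A₀ := a²u², the polynomial P_{a,u}(t) = t⁸ + 6Δt⁶ + (Δ² − 2A₀)t⁴ − 6ΔA₀t² + A₀² is irreducible in ℚ[t]. -/

import Mathlib

theorem Int.sq_emod_eight (x : ℤ) :
    (x % 2 = 0 ∧ (x ^ 2 % 8 = 0 ∨ x ^ 2 % 8 = 4)) ∨ (x % 2 = 1 ∧ x ^ 2 % 8 = 1) := by
  have h : x % 8 = 0 ∨ x % 8 = 1 ∨ x % 8 = 2 ∨ x % 8 = 3 ∨ x % 8 = 4 ∨ x % 8 = 5 ∨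
      x % 8 = 6 ∨ x % 8 = 7 := by omega
  rcases h with h | h | h | h | h | h | h | h <;> simp [pow_two, Int.mul_emod, h] <;> omega

theorem Int.sq_emod_three (x : ℤ) :
    (x % 3 = 0 ∧ x ^ 2 % 3 = 0) ∨ (x % 3 ≠ 0 ∧ x ^ 2 % 3 = 1) := by
  have h : x % 3 = 0 ∨ x % 3 = 1 ∨ x % 3 = 2 := by omega
  rcases h with h | h | h <;> simp [pow_two, Int.mul_emod, h]

theorem IsCoprime.not_both_even {x y : ℤ} (h : IsCoprime x y) : ¬ (x % 2 = 0 ∧ y % 2 = 0) := by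
  rintro ⟨hx, hy⟩
  have := h.isUnit_of_dvd' (Int.dvd_of_emod_eq_zero hx) (Int.dvd_of_emod_eq_zero hy)
  exact absurd (Int.isUnit_iff.mp this) (by norm_num)

theorem IsCoprime.not_both_three_dvd {x y : ℤ} (h : IsCoprime x y) :
    ¬ (x % 3 = 0 ∧ y % 3 = 0) := by
  rintro ⟨hx, hy⟩
  have := h.isUnit_of_dvd' (Int.dvd_of_emod_eq_zero hx) (Int.dvd_of_emod_eq_zero hy)
  exact absurd (Int.isUnit_iff.mp this) (by norm_num)

/-- Common refinement of two factorizations `x * y = z * w` into coprime factors. -/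
theorem Int.exists_four_factors {x y z w : ℤ} (h : x * y = z * w) (hx : x ≠ 0) (hy : y ≠ 0)
    (hxy : IsCoprime x y) :
    ∃ α β γ δ : ℤ, x = α * β ∧ y = γ * δ ∧ z = α * γ ∧ w = β * δ ∧
      IsCoprime β γ ∧ IsCoprime α δ := by
  obtain ⟨γ', β', hcop, hz, hx'⟩ := Int.exists_gcd_one (m := z) (n := x)
    (Int.gcd_pos_of_ne_zero_right _ hx)
  have hg : ((Int.gcd z x : ℕ) : ℤ) ≠ 0 := by
    intro h0; rw [h0, mul_zero] at hx'; exact hx hx'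
  generalize ((Int.gcd z x : ℕ) : ℤ) = g at hz hx' hg
  have hc : IsCoprime β' γ' := (Int.isCoprime_iff_gcd_eq_one.mpr hcop).symm
  have h1 : β' * y = γ' * w := by
    apply mul_left_cancel₀ hg
    rw [hz, hx'] at h
    linear_combination h
  obtain ⟨δ, hδ⟩ : γ' ∣ y := hc.symm.dvd_of_dvd_mul_left ⟨w, h1⟩
  refine ⟨g, β', γ', δ, by rw [hx']; ring, hδ, by rw [hz]; ring, ?_, hc, ?_⟩
  · have hγ : γ' ≠ 0 := by rintro rfl; simp at hδ; exact hy hδ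
    apply mul_left_cancel₀ hγ
    rw [← h1, hδ]; ring
  · rw [hx', hδ] at hxy
    exact hxy.of_mul_left_right.of_mul_right_right

theorem Int.exists_common_multiplier {α δ s t : ℤ} (hα : α ≠ 0) (hαδ : IsCoprime α δ)
    (h : α ^ 2 * s = δ ^ 2 * t) : ∃ k : ℤ, t = k * α ^ 2 ∧ s = k * δ ^ 2 := by
  obtain ⟨k, hk⟩ : α ^ 2 ∣ t := (hαδ.pow (m := 2) (n := 2)).dvd_of_dvd_mul_left ⟨s, h.symm⟩
  refine ⟨k, by rw [hk]; ring, ?_⟩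
  apply mul_left_cancel₀ (pow_ne_zero 2 hα)
  rw [h, hk]; ring

theorem Int.eq_of_dvd_eight {k : ℤ} (h : k ∣ 8) (hk : 0 < k) :
    k = 1 ∨ k = 2 ∨ k = 4 ∨ k = 8 := by
  have := Int.le_of_dvd (by norm_num) h
  interval_cases k <;> omega

theorem Int.dvd_eight_of_coprime {k β γ s t : ℤ} (h : IsCoprime β γ)
    (hβ : 8 * β ^ 2 = k * s) (hγ : 8 * γ ^ 2 = k * t) : k ∣ 8 := by
  obtain ⟨m, n, hmn⟩ := h.pow (m := 2) (n := 2)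
  exact ⟨m * s + n * t, by linear_combination (-8) * hmn + m * hβ + n * hγ⟩

theorem exists_smaller_concordant {x y z w : ℤ} (hx : x ≠ 0) (hy : y ≠ 0)
    (hxy : IsCoprime x y) (h : x * y = z * w) (h2 : x ^ 2 - y ^ 2 = 9 * z ^ 2 - w ^ 2) :
    ∃ α δ : ℤ, α * δ ∣ x * y ∧ (∃ A, δ ^ 2 + α ^ 2 = A ^ 2) ∧ ∃ n, δ ^ 2 + 9 * α ^ 2 = n ^ 2 := by
  obtain ⟨α, β, γ, δ, rfl, rfl, rfl, rfl, hβγ, hαδ⟩ := Int.exists_four_factors h hx hy hxy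
  have hα : α ≠ 0 := left_ne_zero_of_mul hx
  obtain ⟨k, hk1, hk2⟩ := Int.exists_common_multiplier
    (s := 9 * γ ^ 2 - β ^ 2) (t := β ^ 2 - γ ^ 2) hα hαδ (by linear_combination -h2)
  have e1 : 8 * β ^ 2 = k * (9 * α ^ 2 + δ ^ 2) := by linear_combination 9 * hk1 + hk2
  have e2 : 8 * γ ^ 2 = k * (α ^ 2 + δ ^ 2) := by linear_combination hk1 + hk2
  have hβ : β ≠ 0 := right_ne_zero_of_mul hx
  have hkpos : 0 < k := by
    have : 0 < k * (9 * α ^ 2 + δ ^ 2) := by rw [← e1]; positivity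
    exact pos_of_mul_pos_left this (by positivity)
  refine ⟨α, δ, ⟨β * γ, by ring⟩, ?_⟩
  have c1 := hβγ.not_both_even
  have c2 := hαδ.not_both_even
  have sα := Int.sq_emod_eight α
  have sβ := Int.sq_emod_eight β
  have sγ := Int.sq_emod_eight γ
  have sδ := Int.sq_emod_eight δ
  rcases Int.eq_of_dvd_eight (Int.dvd_eight_of_coprime hβγ e1 e2) hkpos with
    rfl | rfl | rfl | rfl
  · omega
  · omega
  · omega
  · exact ⟨⟨γ, by linarith⟩, ⟨β, by linarith⟩⟩

theorem no_even_concordant {x y z w : ℤ} (hx : x ≠ 0) (hy : y ≠ 0)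
    (hxy : IsCoprime x y) (hpar : x * y % 2 = 0) (h : x * y = z * w)
    (h2 : 3 * (x ^ 2 - y ^ 2) = z ^ 2 - w ^ 2) : False := by
  obtain ⟨α, β, γ, δ, rfl, rfl, rfl, rfl, hβγ, hαδ⟩ := Int.exists_four_factors h hx hy hxy
  have hα : α ≠ 0 := left_ne_zero_of_mul hx
  have hβ : β ≠ 0 := right_ne_zero_of_mul hx
  obtain ⟨k, hk1, hk2⟩ := Int.exists_common_multiplier
    (s := 3 * β ^ 2 - γ ^ 2) (t := 3 * γ ^ 2 - β ^ 2) hα hαδ (by linear_combination h2)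
  have e1 : 8 * β ^ 2 = k * (α ^ 2 + 3 * δ ^ 2) := by linear_combination hk1 + 3 * hk2
  have e2 : 8 * γ ^ 2 = k * (3 * α ^ 2 + δ ^ 2) := by linear_combination 3 * hk1 + hk2
  have hkpos : 0 < k := by
    have : 0 < k * (α ^ 2 + 3 * δ ^ 2) := by rw [← e1]; positivity
    exact pos_of_mul_pos_left this (by positivity)
  have c1 := hβγ.not_both_even
  have c2 := hαδ.not_both_even
  have sα := Int.sq_emod_eight α
  have sβ := Int.sq_emod_eight β
  have sγ := Int.sq_emod_eight γ
  have sδ := Int.sq_emod_eight δ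
  have hpar' : α % 2 = 0 ∨ β % 2 = 0 ∨ γ % 2 = 0 ∨ δ % 2 = 0 := by
    have := Int.dvd_of_emod_eq_zero hpar
    simp only [Int.prime_two.dvd_mul] at this
    omega
  rcases Int.eq_of_dvd_eight (Int.dvd_eight_of_coprime hβγ e1 e2) hkpos with
    rfl | rfl | rfl | rfl <;> omega

/-- `1` and `9` are not concordant: `B² + d²` and `B² + 9d²` are never both nonzero squares. -/
theorem no_concordant_one_nine (N : ℕ) : ∀ B d A n : ℤ, (B * d).natAbs = N → B ≠ 0 → d ≠ 0 →
    B ^ 2 + d ^ 2 = A ^ 2 → B ^ 2 + 9 * d ^ 2 = n ^ 2 → False := by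
  induction N using Nat.strong_induction_on with
  | _ N ih =>
  intro B d A n hN hB hd hA hn
  subst hN
  by_cases hcop : IsCoprime B d
  swap
  · obtain ⟨B', d', -, hB', hd'⟩ := Int.exists_gcd_one (m := B) (n := d)
      (Int.gcd_pos_of_ne_zero_left _ hB)
    have hg1 : Int.gcd B d ≠ 1 := fun h => hcop (Int.isCoprime_iff_gcd_eq_one.mpr h)
    have hg0 : 0 < Int.gcd B d := Int.gcd_pos_of_ne_zero_left _ hB
    generalize Int.gcd B d = g at hB' hd' hg1 hg0
    have hB0 : B' ≠ 0 := by rintro rfl; simp at hB'; exact hB hB'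
    have hd0 : d' ≠ 0 := by rintro rfl; simp at hd'; exact hd hd'
    have hgz : (g : ℤ) ≠ 0 := by positivity
    subst hB' hd'
    obtain ⟨A', rfl⟩ : (g : ℤ) ∣ A := by
      rw [← Int.pow_dvd_pow_iff (n := 2) two_ne_zero, ← hA]
      exact ⟨B' ^ 2 + d' ^ 2, by ring⟩
    obtain ⟨n', rfl⟩ : (g : ℤ) ∣ n := by
      rw [← Int.pow_dvd_pow_iff (n := 2) two_ne_zero, ← hn]
      exact ⟨B' ^ 2 + 9 * d' ^ 2, by ring⟩
    refine ih _ ?_ B' d' A' n' rfl hB0 hd0 ?_ ?_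
    · have e : (B' * g * (d' * g)).natAbs = (B' * d').natAbs * (g * g) := by
        simp only [Int.natAbs_mul, Int.natAbs_natCast]; ring
      rw [e]
      have h1 : 0 < (B' * d').natAbs := Int.natAbs_pos.mpr (mul_ne_zero hB0 hd0)
      have h2 : 1 < g := by omega
      have h3 : 1 < g * g := by nlinarith
      exact lt_mul_of_one_lt_right h1 h3
    · apply mul_left_cancel₀ (pow_ne_zero 2 hgz); linear_combination hA
    · apply mul_left_cancel₀ (pow_ne_zero 2 hgz); linear_combination hn
  by_cases h3 : (3 : ℤ) ∣ B
  · obtain ⟨B', rfl⟩ := h3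
    have hB0 : B' ≠ 0 := right_ne_zero_of_mul hB
    obtain ⟨n', rfl⟩ : (3 : ℤ) ∣ n := by
      rw [← Int.pow_dvd_pow_iff (n := 2) two_ne_zero, ← hn]
      exact ⟨B' ^ 2 + d ^ 2, by ring⟩
    refine ih _ ?_ d B' n' A rfl hd hB0 (by linarith) (by linarith)
    have h1 : 0 < (d * B').natAbs := Int.natAbs_pos.mpr (mul_ne_zero hd hB0)
    have e : (3 * B' * d).natAbs = 3 * (d * B').natAbs := by
      rw [mul_assoc, mul_comm B' d, Int.natAbs_mul]; rfl
    omega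
  have hcop3 : IsCoprime B (3 * d) :=
    (((Int.prime_three.coprime_iff_not_dvd).mpr h3).symm).mul_right hcop
  have hA0 : A ≠ 0 := by rintro rfl; have : 0 < B ^ 2 := by positivity
                         nlinarith
  have hn0 : n ≠ 0 := by rintro rfl; have : 0 < B ^ 2 := by positivity
                         nlinarith
  have pA : PythagoreanTriple B d |A| := by
    unfold PythagoreanTriple; rw [abs_mul_abs_self]; linear_combination hA
  have pn : PythagoreanTriple B (3 * d) |n| := by
    unfold PythagoreanTriple; rw [abs_mul_abs_self]; linear_combination hn
  rcases Int.emod_two_eq_zero_or_one B with hpar | hpar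
  · have hdodd : d % 2 = 1 := by have := hcop.not_both_even; omega
    obtain ⟨x, y, hx, hy, -, hg, hp, -⟩ := pA.symm.coprime_classification'
      (Int.isCoprime_iff_gcd_eq_one.mp hcop.symm) hdodd (abs_pos.mpr hA0)
    obtain ⟨z, w, hz, hw, -, -, -, -⟩ := pn.symm.coprime_classification'
      (Int.isCoprime_iff_gcd_eq_one.mp hcop3.symm) (by omega) (abs_pos.mpr hn0)
    have hx0 : x ≠ 0 := by rintro rfl; simp at hy; exact hB hy
    have hy0 : y ≠ 0 := by rintro rfl; simp at hy; exact hB hy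
    refine no_even_concordant hx0 hy0 (Int.isCoprime_iff_gcd_eq_one.mpr hg) ?_
      (z := z) (w := w) (by linarith) (by linarith)
    rcases hp with ⟨hp, -⟩ | ⟨-, hp⟩ <;> simp [Int.mul_emod, hp]
  · obtain ⟨x, y, hx, hy, -, hg, -, -⟩ := pA.coprime_classification'
      (Int.isCoprime_iff_gcd_eq_one.mp hcop) hpar (abs_pos.mpr hA0)
    obtain ⟨z, w, hz, hw, -, -, -, -⟩ := pn.coprime_classification'
      (Int.isCoprime_iff_gcd_eq_one.mp hcop3) hpar (abs_pos.mpr hn0)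
    have hx0 : x ≠ 0 := by rintro rfl; simp at hy; exact hd hy
    have hy0 : y ≠ 0 := by rintro rfl; simp at hy; exact hd hy
    have hxy := Int.isCoprime_iff_gcd_eq_one.mpr hg
    have hzw : 3 * (x * y) = z * w := by linarith
    obtain ⟨α, δ, hdvd, ⟨A', hA'⟩, ⟨n', hn'⟩⟩ : ∃ α δ : ℤ, α * δ ∣ x * y ∧
        (∃ A, δ ^ 2 + α ^ 2 = A ^ 2) ∧ ∃ n, δ ^ 2 + 9 * α ^ 2 = n ^ 2 := by
      rcases Int.prime_three.dvd_or_dvd ⟨_, hzw.symm⟩ with ⟨z', rfl⟩ | ⟨w', rfl⟩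
      · exact exists_smaller_concordant (z := z') (w := w) hx0 hy0 hxy (by linarith) (by linarith)
      · rw [mul_comm x y]
        exact exists_smaller_concordant (z := w') (w := z) hy0 hx0 hxy.symm (by linarith)
          (by linarith)
    have hαδ : α * δ ≠ 0 := ne_zero_of_dvd_ne_zero (mul_ne_zero hx0 hy0) hdvd
    refine ih _ ?_ δ α A' n' rfl (right_ne_zero_of_mul hαδ) (left_ne_zero_of_mul hαδ) hA' hn'
    have h1 : (α * δ).natAbs ≤ (x * y).natAbs :=
      Nat.le_of_dvd (Int.natAbs_pos.mpr (mul_ne_zero hx0 hy0)) (Int.natAbs_dvd_natAbs.mpr hdvd)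
    have h2 : d.natAbs = 2 * (x * y).natAbs := by rw [hy, mul_assoc, Int.natAbs_mul]; rfl
    have h4 : 0 < (x * y).natAbs := Int.natAbs_pos.mpr (mul_ne_zero hx0 hy0)
    have h5 : 0 < B.natAbs := Int.natAbs_pos.mpr hB
    rw [mul_comm δ α, Int.natAbs_mul B d]
    nlinarith

theorem Int.sq_eq_nine_mul_sq {N D m : ℤ} (hND : IsCoprime N D) (hD : D ≠ 0)
    (h : (N ^ 2 - 8 * D ^ 2) * (N ^ 2 - 9 * D ^ 2) = m ^ 2) : N ^ 2 = 9 * D ^ 2 := by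
  have hc : IsCoprime (N ^ 2 - 8 * D ^ 2) (N ^ 2 - 9 * D ^ 2) := by
    obtain ⟨r, s, hrs⟩ := hND.pow (m := 2) (n := 2)
    exact ⟨9 * (-r) + s + 18 * r, -s - 8 * r, by linear_combination hrs⟩
  obtain ⟨A, hA⟩ := Int.sq_of_isCoprime hc h
  obtain ⟨B, hB⟩ := Int.sq_of_isCoprime hc.symm (by rw [mul_comm]; exact h)
  have hDpos : 0 < D ^ 2 := by positivity
  have c2 := hND.not_both_even
  have c3 := hND.not_both_three_dvd
  have N3 := Int.sq_emod_three N
  have D3 := Int.sq_emod_three D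
  have A3 := Int.sq_emod_three A
  have B3 := Int.sq_emod_three B
  by_contra hne
  have hB0 : B ≠ 0 := by
    rintro rfl
    apply hne
    rcases hB with hB | hB <;> linarith
  have hBpos : 0 < B ^ 2 := by positivity
  rcases hA with hA | hA
  · rcases hB with hB | hB
    · exact no_concordant_one_nine _ B D A N rfl hB0 hD (by linarith) (by linarith)
    · have hA0 : A ^ 2 = 0 := by
        rw [hA, hB] at h
        have := sq_nonneg m
        have := sq_nonneg A
        nlinarith
      omega
  · rcases hB with hB | hB
    · have := sq_nonneg A
      linarith
    · omega

theorem Rat.sq_eq_nine_mul_sq {n d m : ℚ} (hd : d ≠ 0)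
    (h : (n ^ 2 - 8 * d ^ 2) * (n ^ 2 - 9 * d ^ 2) = m ^ 2) : n ^ 2 = 9 * d ^ 2 := by
  obtain ⟨r, hn⟩ : ∃ r, n = r * d := ⟨n / d, by field_simp⟩
  have hden : (r.den : ℚ) ≠ 0 := by exact_mod_cast r.den_nz
  have hrnd : r * r.den = r.num := Rat.mul_den_eq_num r
  have hsq : IsSquare ((((r.num ^ 2 - 8 * (r.den : ℤ) ^ 2) *
      (r.num ^ 2 - 9 * (r.den : ℤ) ^ 2) : ℤ)) : ℚ) := by
    refine ⟨m / d ^ 2 * r.den ^ 2, ?_⟩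
    push_cast
    rw [← hrnd]
    have : (r ^ 2 - 8) * (r ^ 2 - 9) = (m / d ^ 2) ^ 2 := by
      rw [div_pow, ← h, hn]
      field_simp
    linear_combination (r.den : ℚ) ^ 4 * this
  obtain ⟨M, hM⟩ := Rat.isSquare_intCast_iff.mp hsq
  have key := Int.sq_eq_nine_mul_sq (N := r.num) (D := (r.den : ℤ)) (m := M)
    (Rat.isCoprime_num_den r) (by exact_mod_cast r.den_nz) (by rw [hM]; ring)
  have key' : (r.num : ℚ) ^ 2 = 9 * (r.den : ℚ) ^ 2 := by exact_mod_cast key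
  have : r ^ 2 = 9 := by
    rw [← hrnd] at key'
    apply mul_right_cancel₀ (pow_ne_zero 2 hden)
    linear_combination key'
  rw [hn]
  linear_combination d ^ 2 * this

theorem Rat.not_exists_sqrt_two_components {Δ b p q : ℚ} (hΔ : Δ ≠ 0) (hb : b ≠ 0)
    (h1 : p ^ 2 + 2 * q ^ 2 = 17 * Δ ^ 2 + 4 * b ^ 2) (h2 : p * q = 6 * Δ ^ 2) : False := by
  have hq : q ≠ 0 := by
    rintro rfl
    have : 0 < Δ ^ 2 := by positivity
    linarith
  have h : ((6 * Δ) ^ 2 - 8 * q ^ 2) * ((6 * Δ) ^ 2 - 9 * q ^ 2) = (12 * b * q) ^ 2 := by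
    linear_combination 36 * q ^ 2 * h1 - (36 * p * q + 216 * Δ ^ 2) * h2
  have h9 := Rat.sq_eq_nine_mul_sq hq h
  rw [h9, sub_self, mul_zero] at h
  have : 12 * b * q ≠ 0 := by positivity
  exact this (pow_eq_zero_iff two_ne_zero |>.mp h.symm)

open IntermediateField in
theorem IntermediateField.exists_add_mul_of_mem_adjoin {K L : Type*} [Field K] [Field L]
    [Algebra K L] (F : IntermediateField K L) {x p q : L} (hp : p ∈ F) (hq : q ∈ F)
    (hx : x ^ 2 = p * x + q) (hint : IsIntegral K x) {z : L} (hz : z ∈ K⟮x⟯) :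
    ∃ c ∈ F, ∃ e ∈ F, z = c + e * x := by
  rw [← IntermediateField.mem_toSubalgebra,
    IntermediateField.adjoin_simple_toSubalgebra_of_isAlgebraic hint.isAlgebraic,
    Algebra.adjoin_singleton_eq_range_aeval] at hz
  obtain ⟨f, rfl⟩ := hz
  change ∃ c ∈ F, ∃ e ∈ F, Polynomial.aeval x f = c + e * x
  induction f using Polynomial.induction_on' with
  | add f g hf hg =>
    obtain ⟨c, hc, e, he, h⟩ := hf
    obtain ⟨c', hc', e', he', h'⟩ := hg
    exact ⟨c + c', add_mem hc hc', e + e', add_mem he he', by rw [map_add, h, h']; ring⟩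
  | monomial n a =>
    induction n with
    | zero => exact ⟨algebraMap K L a, F.algebraMap_mem a, 0, F.zero_mem, by simp⟩
    | succ n ih =>
      obtain ⟨c, hc, e, he, h⟩ := ih
      refine ⟨e * q, mul_mem he hq, c + e * p, add_mem hc (mul_mem he hp), ?_⟩
      rw [Polynomial.aeval_monomial] at h ⊢
      rw [pow_succ, ← mul_assoc, h]
      linear_combination e * hx

theorem IntermediateField.two_mul_finrank_le_of_lt {K L : Type*} [Field K] [Field L]
    [Algebra K L] {F G : IntermediateField K L} [FiniteDimensional K G] (h : F < G) :
    2 * Module.finrank K F ≤ Module.finrank K G := by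
  obtain ⟨m, hm⟩ := IntermediateField.finrank_dvd_of_le_right h.le
  have hpos : 0 < Module.finrank K G := Module.finrank_pos
  have hne : m ≠ 1 := by
    rintro rfl
    exact h.ne (IntermediateField.eq_of_le_of_finrank_eq h.le (by rw [hm, mul_one]))
  have hm0 : m ≠ 0 := by rintro rfl; simp at hm; omega
  have : 2 ≤ m := by omega
  rw [hm]; nlinarith

open IntermediateField in
theorem eight_le_finrank_adjoin {Δ b : ℚ} (hΔ : Δ ≠ 0) (hb : b ≠ 0) {t : ℝ}
    (hint : IsIntegral ℚ t)
    (ht : (t ^ 2) ^ 2 = -(Δ * (3 + 2 * √2)) * t ^ 2 + (b : ℝ) ^ 2) :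
    8 ≤ Module.finrank ℚ ℚ⟮t⟯ := by
  have hb' : (b : ℝ) ≠ 0 := by exact_mod_cast hb
  have hΔ' : (Δ : ℝ) ≠ 0 := by exact_mod_cast hΔ
  have h2 : (√2 : ℝ) ^ 2 = 2 := Real.sq_sqrt (by norm_num)
  have ht0 : t ≠ 0 := by
    rintro rfl
    have : (b : ℝ) ^ 2 ≠ 0 := pow_ne_zero 2 hb'
    apply this; linear_combination -ht
  have hintx : IsIntegral ℚ (t ^ 2) := hint.pow 2
  have hints : IsIntegral ℚ (√2 : ℝ) := by
    refine IsIntegral.of_pow (n := 2) two_pos ?_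
    rw [h2]; exact isIntegral_algebraMap (x := (2 : ℚ))
  have hrat (F : IntermediateField ℚ ℝ) (r : ℚ) : (r : ℝ) ∈ F := F.algebraMap_mem r
  have hirr : Irrational √2 := irrational_sqrt_two
  have hs0 : (√2 : ℝ) ∉ (⊥ : IntermediateField ℚ ℝ) := by
    rintro ⟨r, hr⟩
    exact hirr ⟨r, hr⟩
  have hs : ∀ z ∈ ℚ⟮(√2 : ℝ)⟯, ∃ p q : ℚ, z = p + q * √2 := by
    intro z hz
    obtain ⟨c, hc, e, he, rfl⟩ := IntermediateField.exists_add_mul_of_mem_adjoin ⊥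
      (p := 0) (q := 2) (zero_mem _) (ofNat_mem _ 2) (by rw [h2]; ring) hints hz
    obtain ⟨p, rfl⟩ := hc
    obtain ⟨q, rfl⟩ := he
    exact ⟨p, q, rfl⟩
  have hsmem : (√2 : ℝ) ∈ ℚ⟮(√2 : ℝ)⟯ := mem_adjoin_simple_self _ _
  have hymem : -(Δ * (3 + 2 * √2) : ℝ) ∈ ℚ⟮(√2 : ℝ)⟯ := by
    refine neg_mem (mul_mem (hrat _ _) (add_mem ?_ (mul_mem ?_ hsmem)))
    · exact ofNat_mem _ 3
    · exact ofNat_mem _ 2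
  have hx : t ^ 2 ∉ ℚ⟮(√2 : ℝ)⟯ := by
    intro hmem
    have hw : 2 * t ^ 2 - -(Δ * (3 + 2 * √2) : ℝ) ∈ ℚ⟮(√2 : ℝ)⟯ :=
      sub_mem (mul_mem (ofNat_mem _ 2) hmem) hymem
    obtain ⟨p, q, hpq⟩ := hs _ hw
    have hsq : ((p : ℝ) + q * √2) ^ 2 = Δ ^ 2 * (17 + 12 * √2) + 4 * b ^ 2 := by
      rw [← hpq]
      linear_combination 4 * ht + 4 * (Δ : ℝ) ^ 2 * h2
    have hlin : ((2 * p * q - 12 * Δ ^ 2 : ℚ) : ℝ) * √2 =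
        ((17 * Δ ^ 2 + 4 * b ^ 2 - p ^ 2 - 2 * q ^ 2 : ℚ) : ℝ) := by
      push_cast
      linear_combination hsq - (q : ℝ) ^ 2 * h2
    have h0 : 2 * p * q - 12 * Δ ^ 2 = 0 := by
      by_contra hne
      exact (hirr.ratCast_mul hne) ⟨_, hlin.symm⟩
    rw [h0, Rat.cast_zero, zero_mul] at hlin
    have h1 : 17 * Δ ^ 2 + 4 * b ^ 2 - p ^ 2 - 2 * q ^ 2 = 0 := by exact_mod_cast hlin.symm
    exact Rat.not_exists_sqrt_two_components hΔ hb (p := p) (q := q) (by linarith) (by linarith)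
  have htx : t ∉ ℚ⟮t ^ 2⟯ := by
    intro hmem
    obtain ⟨c, hc, e, he, h⟩ := IntermediateField.exists_add_mul_of_mem_adjoin ℚ⟮(√2 : ℝ)⟯
      hymem (pow_mem (hrat _ b) 2) ht hintx hmem
    set y : ℝ := -(Δ * (3 + 2 * √2)) with hy
    have hlin : (1 - 2 * c * e - e ^ 2 * y) * t ^ 2 = c ^ 2 + e ^ 2 * b ^ 2 := by
      have h' : t ^ 2 = (c + e * t ^ 2) ^ 2 := by rw [← h]
      linear_combination h' + e ^ 2 * ht
    have hcm : c ^ 2 + e ^ 2 * (b : ℝ) ^ 2 ∈ ℚ⟮(√2 : ℝ)⟯ :=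
      add_mem (pow_mem hc 2) (mul_mem (pow_mem he 2) (pow_mem (hrat _ b) 2))
    have h2m : (2 : ℝ) ∈ ℚ⟮(√2 : ℝ)⟯ := ofNat_mem _ 2
    have hkm : 1 - 2 * c * e - e ^ 2 * y ∈ ℚ⟮(√2 : ℝ)⟯ :=
      sub_mem (sub_mem (one_mem _) (mul_mem (mul_mem h2m hc) he)) (mul_mem (pow_mem he 2) hymem)
    have hk0 : 1 - 2 * c * e - e ^ 2 * y = 0 := by
      by_contra hne
      apply hx
      rw [show t ^ 2 = (c ^ 2 + e ^ 2 * (b : ℝ) ^ 2) / (1 - 2 * c * e - e ^ 2 * y) by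
        rw [← hlin]; field_simp]
      exact div_mem hcm hkm
    rw [hk0, zero_mul] at hlin
    have hb2 : 0 < (b : ℝ) ^ 2 := by positivity
    have he0 : e = 0 := by
      by_contra hne
      have : 0 < e ^ 2 * (b : ℝ) ^ 2 := by positivity
      nlinarith [sq_nonneg c]
    rw [he0] at hk0
    norm_num at hk0
  have hsx : (√2 : ℝ) ∈ ℚ⟮t ^ 2⟯ := by
    have hm : t ^ 2 ∈ ℚ⟮t ^ 2⟯ := mem_adjoin_simple_self _ _
    have : (√2 : ℝ) = ((((b : ℝ) ^ 2 - (t ^ 2) ^ 2) / t ^ 2) / Δ - (3 : ℚ)) / (2 : ℚ) := by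
      rw [ht]; push_cast; field_simp; ring
    rw [this]
    exact div_mem (sub_mem (div_mem (div_mem (sub_mem (pow_mem (hrat _ b) 2) (pow_mem hm 2)) hm)
      (hrat _ Δ)) (hrat _ _)) (hrat _ _)
  have l1 : (⊥ : IntermediateField ℚ ℝ) < ℚ⟮(√2 : ℝ)⟯ :=
    lt_of_le_of_ne bot_le fun h => hs0 (h ▸ hsmem)
  have l2 : ℚ⟮(√2 : ℝ)⟯ < ℚ⟮t ^ 2⟯ :=
    lt_of_le_of_ne (adjoin_simple_le_iff.mpr hsx)
      fun h => hx (h ▸ mem_adjoin_simple_self _ _)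
  have l3 : ℚ⟮t ^ 2⟯ < ℚ⟮t⟯ :=
    lt_of_le_of_ne (adjoin_simple_le_iff.mpr (pow_mem (mem_adjoin_simple_self _ _) 2))
      fun h => htx (h ▸ mem_adjoin_simple_self _ _)
  have := adjoin.finiteDimensional hints
  have := adjoin.finiteDimensional hintx
  have := adjoin.finiteDimensional hint
  have f1 := IntermediateField.two_mul_finrank_le_of_lt l1
  have f2 := IntermediateField.two_mul_finrank_le_of_lt l2
  have f3 := IntermediateField.two_mul_finrank_le_of_lt l3
  rw [IntermediateField.finrank_bot] at f1
  omega

theorem exists_real_root {Δ b : ℝ} (hb : b ≠ 0) :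
    ∃ t : ℝ, (t ^ 2) ^ 2 = -(Δ * (3 + 2 * √2)) * t ^ 2 + b ^ 2 := by
  set y : ℝ := -(Δ * (3 + 2 * √2))
  have hs : √(y ^ 2 + 4 * b ^ 2) ^ 2 = y ^ 2 + 4 * b ^ 2 := Real.sq_sqrt (by positivity)
  have hle : -y ≤ √(y ^ 2 + 4 * b ^ 2) :=
    Real.le_sqrt_of_sq_le (by nlinarith [sq_nonneg b])
  refine ⟨√((y + √(y ^ 2 + 4 * b ^ 2)) / 2), ?_⟩
  rw [Real.sq_sqrt (by linarith)]
  linear_combination hs / 4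

open Polynomial

/-- `P_{a,u}` is irreducible in `ℚ[t]`. -/
theorem stmt_15 (a u : ℕ) (ha : 0 < a) (hu : 0 < u) (hau : a ≠ u) (hcop : Nat.Coprime a u)
    (Δ A₀ : ℚ) (hΔ : Δ = (u : ℚ) ^ 2 - (a : ℚ) ^ 2) (hA₀ : A₀ = (a : ℚ) ^ 2 * (u : ℚ) ^ 2) :
    Irreducible (X ^ 8 + C (6 * Δ) * X ^ 6 + C (Δ ^ 2 - 2 * A₀) * X ^ 4
      - C (6 * Δ * A₀) * X ^ 2 + C (A₀ ^ 2) : ℚ[X]) := by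
  set b : ℚ := a * u with hbdef
  have hb : b ≠ 0 := by positivity
  have hA : A₀ = b ^ 2 := by rw [hA₀, hbdef]; ring
  have hΔ0 : Δ ≠ 0 := by
    rw [hΔ, sub_ne_zero]
    intro h
    have h' : u ^ 2 = a ^ 2 := by exact_mod_cast h
    exact hau (Nat.pow_left_injective two_ne_zero h').symm
  obtain ⟨t, ht⟩ := exists_real_root (Δ := (Δ : ℝ)) (b := (b : ℝ)) (by exact_mod_cast hb)
  set P : ℚ[X] := X ^ 8 + C (6 * Δ) * X ^ 6 + C (Δ ^ 2 - 2 * A₀) * X ^ 4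
      - C (6 * Δ * A₀) * X ^ 2 + C (A₀ ^ 2) with hP
  have hdeg : P.natDegree = 8 := by rw [hP]; compute_degree!
  have hmonic : P.Monic := by rw [hP]; monicity!
  have hroot : aeval t P = 0 := by
    have h2 : (√2 : ℝ) ^ 2 = 2 := Real.sq_sqrt (by norm_num)
    simp only [hP, hA, map_add, map_sub, map_mul, map_pow, aeval_X, aeval_C, map_ofNat,
      eq_ratCast]
    linear_combination
      ((t ^ 2) ^ 2 - (b : ℝ) ^ 2 - Δ * (3 + 2 * √2) * t ^ 2 + 6 * Δ * t ^ 2) * ht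
        + 4 * (Δ : ℝ) ^ 2 * t ^ 4 * h2
  have hint : IsIntegral ℚ t := ⟨P, hmonic, hroot⟩
  have h8 := eight_le_finrank_adjoin hΔ0 hb hint ht
  rw [IntermediateField.adjoin.finrank hint] at h8
  have heq : P = minpoly ℚ t :=
    Polynomial.eq_of_monic_of_dvd_of_natDegree_le (minpoly.monic hint) hmonic
      (minpoly.dvd ℚ t hroot) (by rw [hdeg]; exact h8)
  rw [heq]
  exact minpoly.irreducible hint
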